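/- arXiv:1309.0796 — 4 statements merged into one kernel-verified Lean document; each statement's English description precedes it below -/
import Mathlib

section
/- The positive braid monoid B_n^+ is left-cancellative: for all a, b, c in B_n^+, if a * b = a * c then b = c. -/
/-- The braid relations on the free monoid over `Fin (n - 1)`: the index `i : Fin (n - 1)`
stands for the Artin generator `σ_{i+1}` (indices are 0-based), and the relations are
`σ_i σ_j σ_i = σ_j σ_i σ_j` for `|i - j| = 1` and `σ_i σ_j = σ_j σ_i` for `|i - j| ≥ 2`. -/
def braidRels (n : ℕ) : FreeMonoid (Fin (n - 1)) → FreeMonoid (Fin (n - 1)) → Prop :=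
  fun x y =>
    (∃ i j : Fin (n - 1), (i : ℕ) + 1 = (j : ℕ) ∧
        x = .of i * .of j * .of i ∧ y = .of j * .of i * .of j) ∨
    (∃ i j : Fin (n - 1), (i : ℕ) + 2 ≤ (j : ℕ) ∧
        x = .of i * .of j ∧ y = .of j * .of i)

/-- The positive braid monoid `B_n⁺`, presented by the generators `σ_1, …, σ_{n-1}`
and the braid relations. -/
def BraidMonoid (n : ℕ) := PresentedMonoid (braidRels n)

instance (n : ℕ) : Monoid (BraidMonoid n) :=
  inferInstanceAs (Monoid (PresentedMonoid (braidRels n)))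

/-- The generator `σ_{i+1}` of `B_n⁺` (0-based index `i : Fin (n - 1)`). -/
def σ {n : ℕ} (i : Fin (n - 1)) : BraidMonoid n := PresentedMonoid.of (braidRels n) i

namespace BraidMonoid

variable {n : ℕ}

/-- The indices of two commuting generators at distance at least two. -/
def Far (i j : Fin (n - 1)) : Prop := (i : ℕ) + 2 ≤ j ∨ (j : ℕ) + 2 ≤ i

/-- The indices of two consecutive generators. -/
def Adj (i j : Fin (n - 1)) : Prop := (i : ℕ) + 1 = j ∨ (j : ℕ) + 1 = i

lemma Far.symm {i j : Fin (n - 1)} (h : Far i j) : Far j i := Or.symm h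

lemma Adj.symm {i j : Fin (n - 1)} (h : Adj i j) : Adj j i := Or.symm h

lemma eq_or_far_or_adj (i j : Fin (n - 1)) : i = j ∨ Far i j ∨ Adj i j := by
  unfold Far Adj
  rw [Fin.ext_iff]
  omega

/-- The class of a word in the braid monoid. -/
def ofWord : FreeMonoid (Fin (n - 1)) →* BraidMonoid n := PresentedMonoid.mk (braidRels n)

lemma ofWord_of (i : Fin (n - 1)) : ofWord (.of i) = (σ i : BraidMonoid n) := rfl

lemma ofWord_eq_ofWord_iff {x y : FreeMonoid (Fin (n - 1))} :
    ofWord x = ofWord y ↔ conGen (braidRels n) x y := PresentedMonoid.mk_eq_mk_iff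

lemma ofWord_surjective : Function.Surjective (ofWord (n := n)) := PresentedMonoid.surjective_mk

lemma σ_mul_comm {i j : Fin (n - 1)} (h : Far i j) (x : BraidMonoid n) :
    σ i * (σ j * x) = σ j * (σ i * x) := by
  have key : ∀ i j : Fin (n - 1), (i : ℕ) + 2 ≤ j →
      (σ i * σ j : BraidMonoid n) = σ j * σ i := fun i j hij ↦
    PresentedMonoid.mk_eq_mk_of_rel (Or.inr ⟨i, j, hij, rfl, rfl⟩)
  rcases h with h | h
  · rw [← mul_assoc, key i j h, mul_assoc]
  · rw [← mul_assoc, ← key j i h, mul_assoc]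

lemma σ_braid {i j : Fin (n - 1)} (h : Adj i j) (x : BraidMonoid n) :
    σ i * (σ j * (σ i * x)) = σ j * (σ i * (σ j * x)) := by
  have key : ∀ i j : Fin (n - 1), (i : ℕ) + 1 = j →
      (σ i * σ j * σ i : BraidMonoid n) = σ j * σ i * σ j := fun i j hij ↦
    PresentedMonoid.mk_eq_mk_of_rel (Or.inl ⟨i, j, hij, rfl, rfl⟩)
  simp only [← mul_assoc]
  rcases h with h | h
  · rw [key i j h]
  · rw [key j i h]

/-- The word length, as a homomorphism. -/
def lengthHom (n : ℕ) : BraidMonoid n →* Multiplicative ℕ :=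
  PresentedMonoid.lift (fun _ ↦ Multiplicative.ofAdd 1) (by
    rintro _ _ (⟨i, j, -, rfl, rfl⟩ | ⟨i, j, -, rfl, rfl⟩) <;> simp)

/-- The word length of a positive braid. -/
def len (x : BraidMonoid n) : ℕ := (lengthHom n x).toAdd

@[simp] lemma len_one : len (1 : BraidMonoid n) = 0 := by simp [len]

@[simp] lemma len_σ_mul (i : Fin (n - 1)) (x : BraidMonoid n) : len (σ i * x) = len x + 1 := by
  rw [add_comm]
  simp only [len, map_mul, toAdd_mul]
  rfl

/-- Garside's description of the equality `σ i * x = σ j * y`: both sides are multiples of the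
least common multiple of `σ i` and `σ j`. -/
def LcmRel (i : Fin (n - 1)) (x : BraidMonoid n) (j : Fin (n - 1)) (y : BraidMonoid n) : Prop :=
  (i = j ∧ x = y) ∨ (Far i j ∧ ∃ z, x = σ j * z ∧ y = σ i * z) ∨
    (Adj i j ∧ ∃ z, x = σ j * (σ i * z) ∧ y = σ i * (σ j * z))

lemma LcmRel.symm {i j : Fin (n - 1)} {x y : BraidMonoid n} (h : LcmRel i x j y) :
    LcmRel j y i x := by
  rcases h with ⟨rfl, rfl⟩ | ⟨h, z, hx, hy⟩ | ⟨h, z, hx, hy⟩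
  · exact Or.inl ⟨rfl, rfl⟩
  · exact Or.inr (Or.inl ⟨h.symm, z, hy, hx⟩)
  · exact Or.inr (Or.inr ⟨h.symm, z, hy, hx⟩)

lemma LcmRel.mul_right {i j : Fin (n - 1)} {x y : BraidMonoid n} (h : LcmRel i x j y)
    (w : BraidMonoid n) : LcmRel i (x * w) j (y * w) := by
  rcases h with ⟨rfl, rfl⟩ | ⟨h, z, rfl, rfl⟩ | ⟨h, z, rfl, rfl⟩
  · exact Or.inl ⟨rfl, rfl⟩
  · exact Or.inr (Or.inl ⟨h, z * w, by simp only [mul_assoc], by simp only [mul_assoc]⟩)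
  · exact Or.inr (Or.inr ⟨h, z * w, by simp only [mul_assoc], by simp only [mul_assoc]⟩)

/-- Garside's lemma for braids `x` of length less than `m`. -/
def GarsideBelow (n m : ℕ) : Prop :=
  ∀ (i j : Fin (n - 1)) (x y : BraidMonoid n), len x < m → σ i * x = σ j * y → LcmRel i x j y

lemma Far.not_adj {i j : Fin (n - 1)} (h : Far i j) : ¬ Adj i j := by
  unfold Far Adj at *
  omega

lemma Far.ne {i j : Fin (n - 1)} (h : Far i j) : i ≠ j := by
  rintro rfl
  unfold Far at h
  omega

lemma Adj.ne {i j : Fin (n - 1)} (h : Adj i j) : i ≠ j := by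
  rintro rfl
  unfold Adj at h
  omega

lemma far_of_adj_adj {i j k : Fin (n - 1)} (hik : Adj i k) (hkj : Adj k j) (hij : i ≠ j) :
    Far i j := by
  unfold Far Adj at *
  rw [Ne, Fin.ext_iff] at hij
  omega

namespace GarsideBelow

variable {m : ℕ} {i j : Fin (n - 1)} {x y : BraidMonoid n}

lemma cancel (H : GarsideBelow n m) (hx : len x < m) (h : σ i * x = σ i * y) : x = y := by
  rcases H i i x y hx h with ⟨-, h⟩ | ⟨h, -⟩ | ⟨h, -⟩
  · exact h
  · exact absurd rfl h.ne
  · exact absurd rfl h.ne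

lemma of_far (H : GarsideBelow n m) (hx : len x < m) (hij : Far i j) (h : σ i * x = σ j * y) :
    ∃ z, x = σ j * z ∧ y = σ i * z := by
  rcases H i j x y hx h with ⟨h, -⟩ | ⟨-, h⟩ | ⟨h, -⟩
  · exact absurd h hij.ne
  · exact h
  · exact absurd h hij.not_adj

lemma of_adj (H : GarsideBelow n m) (hx : len x < m) (hij : Adj i j) (h : σ i * x = σ j * y) :
    ∃ z, x = σ j * (σ i * z) ∧ y = σ i * (σ j * z) := by
  rcases H i j x y hx h with ⟨h, -⟩ | ⟨h, -⟩ | ⟨-, h⟩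
  · exact absurd h hij.ne
  · exact absurd hij h.not_adj
  · exact h

variable {k : Fin (n - 1)}

lemma lcmRel_of_far_far (H : GarsideBelow n m) (hik : Far i k) (hkj : Far k j)
    {p q : BraidMonoid n} (hm : len p < m) (h : σ i * p = σ j * q) :
    LcmRel i (σ k * p) j (σ k * q) := by
  rcases H i j p q hm h with ⟨rfl, rfl⟩ | ⟨hij, z, rfl, rfl⟩ | ⟨hij, z, rfl, rfl⟩
  · exact Or.inl ⟨rfl, rfl⟩
  · exact Or.inr (Or.inl ⟨hij, σ k * z, σ_mul_comm hkj z, σ_mul_comm hik.symm z⟩)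
  · refine Or.inr (Or.inr ⟨hij, σ k * z, ?_, ?_⟩)
    · rw [σ_mul_comm hkj, σ_mul_comm hik.symm]
    · rw [σ_mul_comm hik.symm, σ_mul_comm hkj]

lemma lcmRel_of_adj_far (H : GarsideBelow n m) (hik : Adj i k) (hkj : Far k j)
    {p q : BraidMonoid n} (hm : len p + 1 < m) (h : σ i * (σ k * p) = σ j * q) :
    LcmRel i (σ k * (σ i * p)) j (σ k * q) := by
  rcases eq_or_far_or_adj i j with rfl | hij | hij
  · exact absurd hik.symm hkj.not_adj
  · obtain ⟨w, hw, rfl⟩ := H.of_far (by simpa using hm) hij h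
    obtain ⟨u, rfl, rfl⟩ := H.of_far (by omega) hkj hw
    refine Or.inr (Or.inl ⟨hij, σ k * (σ i * u), ?_, ?_⟩)
    · rw [σ_mul_comm hij, σ_mul_comm hkj]
    · rw [σ_braid hik]
  · obtain ⟨w, hw, rfl⟩ := H.of_adj (by simpa using hm) hij h
    obtain ⟨u, rfl, hu⟩ := H.of_far (by omega) hkj hw
    have hlen := congrArg len hu
    simp only [len_σ_mul] at hlen hm
    obtain ⟨v, rfl, rfl⟩ := H.of_adj (by omega) hik hu
    refine Or.inr (Or.inr ⟨hij, σ k * (σ i * (σ j * v)), ?_, ?_⟩)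
    · rw [σ_braid hij, σ_mul_comm hkj, σ_mul_comm hkj.symm v, σ_braid hik.symm]
    · rw [σ_mul_comm hkj.symm (σ i * v), σ_braid hik.symm, σ_braid hij, σ_mul_comm hkj]

lemma lcmRel_of_adj_adj (H : GarsideBelow n m) (hik : Adj i k) (hkj : Adj k j)
    {p q : BraidMonoid n} (hm : len p + 1 < m) (h : σ i * (σ k * p) = σ j * (σ k * q)) :
    LcmRel i (σ k * (σ i * p)) j (σ k * (σ j * q)) := by
  have hlen := congrArg len h
  simp only [len_σ_mul] at hlen
  by_cases hij : i = j
  · subst hij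
    have hpq := H.cancel (by omega) (H.cancel (by simpa using hm) h)
    exact Or.inl ⟨rfl, by rw [hpq]⟩
  · have hfar := far_of_adj_adj hik hkj hij
    obtain ⟨w, hp, hq⟩ := H.of_far (by simpa using hm) hfar h
    obtain ⟨u, rfl, rfl⟩ := H.of_adj (by omega) hkj hp
    obtain ⟨v, rfl, hv⟩ := H.of_adj (by omega) hik.symm hq
    simp only [len_σ_mul] at hm
    have huv := H.cancel (by simp only [len_σ_mul]; omega) hv
    obtain ⟨t, rfl, rfl⟩ := H.of_far (by omega) hfar.symm huv
    refine Or.inr (Or.inl ⟨hfar, σ k * (σ i * (σ j * (σ k * t))), ?_, ?_⟩)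
    · rw [σ_mul_comm hfar, σ_braid hik, σ_braid hkj, σ_mul_comm hfar]
    · rw [σ_mul_comm hfar.symm, σ_braid hkj.symm, σ_braid hik.symm]

lemma lcmRel_trans (H : GarsideBelow n m) {v : BraidMonoid n} (hv : len v = m)
    (h₁ : LcmRel i x k v) (h₂ : LcmRel k v j y) : LcmRel i x j y := by
  rcases h₁ with ⟨rfl, rfl⟩ | ⟨hik, p, rfl, rfl⟩ | ⟨hik, p, rfl, rfl⟩
  · exact h₂
  · rcases h₂ with ⟨rfl, rfl⟩ | ⟨hkj, q, h, rfl⟩ | ⟨hkj, q, h, rfl⟩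
    · exact Or.inr (Or.inl ⟨hik, p, rfl, rfl⟩)
    · exact H.lcmRel_of_far_far hik hkj (by simp at hv; omega) h
    · have hlen := congrArg len h
      simp only [len_σ_mul] at hlen hv
      exact (H.lcmRel_of_adj_far hkj.symm hik.symm (by omega) h.symm).symm
  · rcases h₂ with ⟨rfl, rfl⟩ | ⟨hkj, q, h, rfl⟩ | ⟨hkj, q, h, rfl⟩
    · exact Or.inr (Or.inr ⟨hik, p, rfl, rfl⟩)
    · exact H.lcmRel_of_adj_far hik hkj (by simp at hv; omega) h
    · exact H.lcmRel_of_adj_adj hik hkj (by simp at hv; omega) h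

end GarsideBelow

lemma GarsideBelow.mono {m m' : ℕ} (H : GarsideBelow n m) (h : m' ≤ m) : GarsideBelow n m' :=
  fun i j x y hx ↦ H i j x y (hx.trans_le h)

lemma len_mul (x y : BraidMonoid n) : len (x * y) = len x + len y := by simp [len]

lemma len_ofWord_eq {x y : FreeMonoid (Fin (n - 1))} (h : ConGen.Rel (braidRels n) x y) :
    len (ofWord x) = len (ofWord y) :=
  congrArg len (ofWord_eq_ofWord_iff.2 h)

lemma len_ofWord_of_mul (i : Fin (n - 1)) (x : FreeMonoid (Fin (n - 1))) :
    len (ofWord (.of i * x)) = len (ofWord x) + 1 := by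
  rw [map_mul, ofWord_of, len_σ_mul]

lemma eq_one_or_exists_eq_of_mul (x : FreeMonoid (Fin (n - 1))) :
    x = 1 ∨ ∃ i y, x = .of i * y := by
  induction x using FreeMonoid.casesOn with
  | one => exact Or.inl rfl
  | of_mul i y => exact Or.inr ⟨i, y, rfl⟩

lemma of_mul_inj {i j : Fin (n - 1)} {x y : FreeMonoid (Fin (n - 1))}
    (h : FreeMonoid.of i * x = .of j * y) : i = j ∧ x = y :=
  List.cons.inj h

lemma lcmRel_of_braidRels {x y : FreeMonoid (Fin (n - 1))} (h : braidRels n x y)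
    {i j : Fin (n - 1)} {u v : FreeMonoid (Fin (n - 1))}
    (hx : x = .of i * u) (hy : y = .of j * v) : LcmRel i (ofWord u) j (ofWord v) := by
  rcases h with ⟨a, b, hab, rfl, rfl⟩ | ⟨a, b, hab, rfl, rfl⟩
  · rw [mul_assoc] at hx hy
    obtain ⟨rfl, rfl⟩ := of_mul_inj hx
    obtain ⟨rfl, rfl⟩ := of_mul_inj hy
    exact Or.inr (Or.inr ⟨Or.inl hab, 1, by simp [ofWord_of], by simp [ofWord_of]⟩)
  · obtain ⟨rfl, rfl⟩ := of_mul_inj hx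
    obtain ⟨rfl, rfl⟩ := of_mul_inj hy
    exact Or.inr (Or.inl ⟨Or.inl hab, 1, by simp [ofWord_of], by simp [ofWord_of]⟩)

lemma lcmRel_of_conGen {m : ℕ} (H : GarsideBelow n m) {x y : FreeMonoid (Fin (n - 1))}
    (hxy : ConGen.Rel (braidRels n) x y) {i j : Fin (n - 1)} {u v : FreeMonoid (Fin (n - 1))}
    (hx : x = .of i * u) (hy : y = .of j * v) (hu : len (ofWord u) = m) :
    LcmRel i (ofWord u) j (ofWord v) := by
  induction hxy generalizing i j u v m with
  | of x y h => exact lcmRel_of_braidRels h hx hy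
  | refl x =>
    obtain ⟨rfl, rfl⟩ := of_mul_inj (hx.symm.trans hy)
    exact Or.inl ⟨rfl, rfl⟩
  | symm h ih =>
    have hlen := len_ofWord_eq h
    rw [hx, hy, len_ofWord_of_mul, len_ofWord_of_mul] at hlen
    exact (ih H hy hx (by omega)).symm
  | @trans x y z h₁ h₂ ih₁ ih₂ =>
    have hlen := len_ofWord_eq h₁
    rw [hx, len_ofWord_of_mul] at hlen
    rcases eq_one_or_exists_eq_of_mul y with rfl | ⟨k, w, rfl⟩
    · simp at hlen
    · rw [len_ofWord_of_mul] at hlen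
      have hw : len (ofWord w) = m := by omega
      exact H.lcmRel_trans hw (ih₁ H hx rfl hu) (ih₂ H rfl hy hw)
  | @mul a b c d h₁ h₂ ih₁ ih₂ =>
    have hlen := len_ofWord_eq h₁
    rcases eq_one_or_exists_eq_of_mul a with rfl | ⟨k, a, rfl⟩ <;>
      rcases eq_one_or_exists_eq_of_mul b with rfl | ⟨l, b, rfl⟩
    · rw [one_mul] at hx hy
      exact ih₂ H hx hy hu
    · rw [len_ofWord_of_mul] at hlen
      simp at hlen
    · rw [len_ofWord_of_mul] at hlen
      simp at hlen
    · rw [mul_assoc] at hx hy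
      obtain ⟨rfl, rfl⟩ := of_mul_inj hx
      obtain ⟨rfl, rfl⟩ := of_mul_inj hy
      rw [map_mul, len_mul] at hu
      have hcd : ofWord c = ofWord d := ofWord_eq_ofWord_iff.2 h₂
      rw [map_mul, map_mul, ← hcd]
      exact (ih₁ (H.mono (by omega)) rfl rfl rfl).mul_right _

lemma garsideBelow (n m : ℕ) : GarsideBelow n m := by
  induction m with
  | zero => exact fun _ _ _ _ h ↦ absurd h (Nat.not_lt_zero _)
  | succ m H =>
    intro i j x y hx h
    rcases Nat.lt_succ_iff_lt_or_eq.1 hx with hx | hx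
    · exact H i j x y hx h
    obtain ⟨u, rfl⟩ := ofWord_surjective x
    obtain ⟨v, rfl⟩ := ofWord_surjective y
    rw [← ofWord_of, ← ofWord_of, ← map_mul, ← map_mul, ofWord_eq_ofWord_iff] at h
    exact lcmRel_of_conGen H h rfl rfl hx

lemma σ_mul_left_cancel {i : Fin (n - 1)} {x y : BraidMonoid n} (h : σ i * x = σ i * y) :
    x = y :=
  (garsideBelow n (len x + 1)).cancel (Nat.lt_succ_self _) h

end BraidMonoid

/-- The positive braid monoid `B_n⁺` is left-cancellative. -/
theorem braidMonoid_left_cancellative (n : ℕ) (hn : 1 ≤ n) :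
    ∀ a b c : BraidMonoid n, a * b = a * c → b = c := by
  intro a b c h
  obtain ⟨w, rfl⟩ := BraidMonoid.ofWord_surjective a
  induction w using FreeMonoid.inductionOn' with
  | one => simpa using h
  | of_mul i w ih =>
    rw [map_mul, BraidMonoid.ofWord_of, mul_assoc, mul_assoc] at h
    exact ih (BraidMonoid.σ_mul_left_cancel h)
end

section
/- Every element of the positive braid monoid B_n^+ left-divides some power of Garside's fundamental element: for every g in B_n^+ there exist m ≥ 0 and h in B_n^+ such that g * h = Δ_n^m. -/
/-- `desc n k = σ_k σ_{k-1} ⋯ σ_1` (1-based indices; `desc n 0 = 1`). -/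
def desc (n : ℕ) : ℕ → BraidMonoid n
  | 0 => 1
  | k + 1 => (if h : k < n - 1 then σ ⟨k, h⟩ else 1) * desc n k

/-- `deltaAux n m` is Garside's fundamental element `Δ_m` computed inside `B_n⁺`:
`Δ_1 = 1` and `Δ_{m+1} = Δ_m ⬝ (σ_m σ_{m-1} ⋯ σ_1)`. -/
def deltaAux (n : ℕ) : ℕ → BraidMonoid n
  | 0 => 1
  | m + 1 => deltaAux n m * desc n m

/-- Garside's fundamental element `Δ_n` of the positive braid monoid `B_n⁺`. -/
def Δ (n : ℕ) : BraidMonoid n := deltaAux n n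

namespace BraidMonoid

variable {n : ℕ}

/-- The generators of `B_n⁺` indexed by natural numbers, extended by `1` outside the range. -/
def gen (n k : ℕ) : BraidMonoid n := if h : k < n - 1 then σ ⟨k, h⟩ else 1

theorem desc_succ (k : ℕ) : desc n (k + 1) = gen n k * desc n k := rfl

theorem deltaAux_succ (m : ℕ) : deltaAux n (m + 1) = deltaAux n m * desc n m := rfl

theorem gen_of_fin (i : Fin (n - 1)) : gen n i = σ i := dif_pos i.2

theorem mk_eq_of_rel {x y : FreeMonoid (Fin (n - 1))} (h : braidRels n x y) :
    PresentedMonoid.mk (braidRels n) x = PresentedMonoid.mk (braidRels n) y :=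
  Quotient.sound (ConGen.Rel.of _ _ h)

theorem gen_braid {k : ℕ} (hk : k + 1 < n - 1) :
    gen n k * gen n (k + 1) * gen n k = gen n (k + 1) * gen n k * gen n (k + 1) := by
  rw [gen, gen, dif_pos hk, dif_pos (by omega)]
  exact mk_eq_of_rel (Or.inl ⟨⟨k, by omega⟩, ⟨k + 1, hk⟩, rfl, rfl, rfl⟩)

theorem commute_gen {i j : ℕ} (h : i + 2 ≤ j) : Commute (gen n i) (gen n j) := by
  by_cases hj : j < n - 1
  · rw [gen, gen, dif_pos hj, dif_pos (by omega)]
    exact mk_eq_of_rel (Or.inr ⟨⟨i, by omega⟩, ⟨j, hj⟩, h, rfl, rfl⟩)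
  · rw [gen, gen, dif_neg hj]
    exact Commute.one_right _

theorem commute_desc_gen {k j : ℕ} (h : k < j) : Commute (desc n k) (gen n j) := by
  induction k with
  | zero => exact Commute.one_left _
  | succ k ih => exact (commute_gen h).mul_left (ih (by omega))

theorem commute_deltaAux_gen {k j : ℕ} (h : k ≤ j) : Commute (deltaAux n k) (gen n j) := by
  induction k with
  | zero => exact Commute.one_left _
  | succ k ih => exact (ih (by omega)).mul_left (commute_desc_gen h)

theorem desc_mul_gen_succ {k j : ℕ} (hk : k ≤ n - 1) (hj : j + 1 < k) :
    desc n k * gen n (j + 1) = gen n j * desc n k := by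
  induction k with
  | zero => omega
  | succ k ih =>
    rcases (by omega : j + 1 < k ∨ k = j + 1) with h | rfl
    · rw [desc_succ, mul_assoc, ih (by omega) h, ← mul_assoc, ← mul_assoc,
        (commute_gen (by omega : j + 2 ≤ k)).eq]
    · rw [desc_succ, desc_succ, mul_assoc, mul_assoc,
        (commute_desc_gen (Nat.lt_succ_self j)).eq]
      simp only [← mul_assoc]
      rw [gen_braid (by omega)]

theorem desc_mul_desc_mul_gen_zero {j k : ℕ} (hk : k < n - 1) (hj : j ≤ k) :
    desc n j * desc n (k + 1) * gen n 0 = desc n (k + 1) * desc n (j + 1) := by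
  induction j with
  | zero => simp [desc, gen]
  | succ j ih =>
    rw [desc_succ j, mul_assoc, mul_assoc, ← mul_assoc (desc n j), ih (by omega), ← mul_assoc,
      ← desc_mul_gen_succ hk (by omega), mul_assoc, ← desc_succ]

theorem exists_desc_mul_desc_eq {j k : ℕ} (hk : k < n - 1) (hj : j ≤ k) :
    ∃ x, desc n j * desc n (k + 1) = desc n (k + 1) * x := by
  induction j with
  | zero => exact ⟨1, by simp [desc]⟩
  | succ j ih =>
    obtain ⟨x, hx⟩ := ih (by omega)
    refine ⟨gen n (j + 1) * x, ?_⟩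
    rw [desc_succ j, mul_assoc, hx, ← mul_assoc, ← desc_mul_gen_succ hk (by omega), mul_assoc]

theorem deltaAux_mul_gen {m i j : ℕ} (hm : m ≤ n) (h : i + j + 2 = m) :
    deltaAux n m * gen n j = gen n i * deltaAux n m := by
  induction m generalizing j with
  | zero => omega
  | succ m ih =>
    cases j with
    | succ j =>
      rw [deltaAux_succ, mul_assoc, desc_mul_gen_succ (by omega) (by omega), ← mul_assoc,
        ih (by omega) (by omega), mul_assoc]
    | zero =>
      obtain rfl : m = i + 1 := by omega
      rw [deltaAux_succ, deltaAux_succ, mul_assoc, mul_assoc, ← mul_assoc (desc n i),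
        desc_mul_desc_mul_gen_zero (by omega) le_rfl]
      nth_rw 1 [desc_succ]
      simp only [← mul_assoc]
      rw [(commute_deltaAux_gen le_rfl).eq]

theorem gen_dvd_deltaAux {m i : ℕ} (hm : m ≤ n) (hi : i + 1 < m) : gen n i ∣ deltaAux n m := by
  induction m with
  | zero => omega
  | succ m ih =>
    rcases (by omega : i + 1 < m ∨ m = i + 1) with h | rfl
    · exact (ih (by omega) h).mul_right _
    · obtain ⟨x, hx⟩ := exists_desc_mul_desc_eq (n := n) (by omega : i < n - 1) le_rfl
      rw [deltaAux_succ, deltaAux_succ, mul_assoc, hx, desc_succ, ← mul_assoc, ← mul_assoc,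
        (commute_deltaAux_gen le_rfl).eq]
      simp only [mul_assoc]
      exact dvd_mul_right _ _

theorem σ_dvd_Δ (i : Fin (n - 1)) : σ i ∣ Δ n := by
  rw [← gen_of_fin]
  exact gen_dvd_deltaAux le_rfl (by omega)

theorem σ_mul_Δ (i : Fin (n - 1)) : σ i * Δ n = Δ n * σ i.rev := by
  rw [← gen_of_fin, ← gen_of_fin]
  exact (deltaAux_mul_gen le_rfl (by rw [Fin.val_rev]; omega)).symm

theorem exists_σ_mul_Δ_pow (i : Fin (n - 1)) (m : ℕ) : ∃ j, σ i * Δ n ^ m = Δ n ^ m * σ j := by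
  induction m with
  | zero => exact ⟨i, by simp⟩
  | succ m ih =>
    obtain ⟨j, hj⟩ := ih
    exact ⟨j.rev, by rw [pow_succ, ← mul_assoc, hj, mul_assoc, σ_mul_Δ, mul_assoc]⟩

theorem dvd_Δ_pow_σ_mul {g : BraidMonoid n} {m : ℕ} (hg : g ∣ Δ n ^ m) (i : Fin (n - 1)) :
    σ i * g ∣ Δ n ^ (m + 1) := by
  obtain ⟨j, hj⟩ := exists_σ_mul_Δ_pow i m
  calc σ i * g ∣ σ i * Δ n ^ m := mul_dvd_mul_left _ hg
    _ = Δ n ^ m * σ j := hj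
    _ ∣ Δ n ^ m * Δ n := mul_dvd_mul_left _ (σ_dvd_Δ j)
    _ = Δ n ^ (m + 1) := (pow_succ _ _).symm

theorem exists_dvd_Δ_pow (g : BraidMonoid n) : ∃ m, g ∣ Δ n ^ m := by
  obtain ⟨w, rfl⟩ := PresentedMonoid.surjective_mk (rels := braidRels n) g
  induction w using FreeMonoid.inductionOn' with
  | one => exact ⟨0, one_dvd _⟩
  | of_mul i w ih =>
    obtain ⟨m, hm⟩ := ih
    exact ⟨m + 1, dvd_Δ_pow_σ_mul hm i⟩

end BraidMonoid

/-- Every element of the positive braid monoid `B_n⁺` left-divides some power of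
Garside's fundamental element `Δ_n`. -/
theorem braidMonoid_dvd_delta_pow (n : ℕ) (hn : 1 ≤ n) (g : BraidMonoid n) :
    ∃ (m : ℕ) (h : BraidMonoid n), g * h = Δ n ^ m := by
  obtain ⟨m, h, e⟩ := BraidMonoid.exists_dvd_Δ_pow g
  exact ⟨m, h, e.symm⟩
end

section
/- Every element of the braid group B_n can be expressed as a fraction Δ_n^m · g where m is an integer and g lies in the image of the positive braid monoid B_n^+ under the canonical homomorphism B_n^+ → B_n. -/
/-- The braid relators in the free group over `Fin (n - 1)`: the index `i` stands for the
Artin generator `σ_{i+1}` (indices are 0-based), and the relators express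
`σ_i σ_j σ_i = σ_j σ_i σ_j` for `|i - j| = 1` and `σ_i σ_j = σ_j σ_i` for `|i - j| ≥ 2`. -/
def braidRelsGroup (n : ℕ) : Set (FreeGroup (Fin (n - 1))) :=
  { r | (∃ i j : Fin (n - 1), (i : ℕ) + 1 = (j : ℕ) ∧
          r = .of i * .of j * .of i * (.of j * .of i * .of j)⁻¹) ∨
        (∃ i j : Fin (n - 1), (i : ℕ) + 2 ≤ (j : ℕ) ∧
          r = .of i * .of j * (.of j * .of i)⁻¹) }

/-- The braid group `B_n`, presented by the generators `σ_1, …, σ_{n-1}` and the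
braid relations. -/
def BraidGroup (n : ℕ) := PresentedGroup (braidRelsGroup n)

instance (n : ℕ) : Group (BraidGroup n) :=
  inferInstanceAs (Group (PresentedGroup (braidRelsGroup n)))

/-- The generator `σ_{i+1}` of the braid group `B_n` (0-based index `i : Fin (n - 1)`). -/
def σG {n : ℕ} (i : Fin (n - 1)) : BraidGroup n := PresentedGroup.of i

theorem braidGroup_rel_eq {n : ℕ} {x y : FreeGroup (Fin (n - 1))}
    (hr : x * y⁻¹ ∈ braidRelsGroup n) :
    PresentedGroup.mk (braidRelsGroup n) x = PresentedGroup.mk (braidRelsGroup n) y := by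
  have h1 : PresentedGroup.mk (braidRelsGroup n) (x * y⁻¹) = 1 :=
    (QuotientGroup.eq_one_iff _).mpr (Subgroup.subset_normalClosure hr)
  rw [map_mul, map_inv] at h1
  exact mul_inv_eq_one.mp h1

theorem braidRels_hold (n : ℕ) (a b : FreeMonoid (Fin (n - 1))) (h : braidRels n a b) :
    FreeMonoid.lift (fun i => σG (n := n) i) a = FreeMonoid.lift (fun i => σG (n := n) i) b := by
  obtain ⟨i, j, hij, rfl, rfl⟩ | ⟨i, j, hij, rfl, rfl⟩ := h
  · simp only [map_mul, FreeMonoid.lift_eval_of]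
    exact braidGroup_rel_eq (Or.inl ⟨i, j, hij, by simp [mul_assoc]⟩)
  · simp only [map_mul, FreeMonoid.lift_eval_of]
    exact braidGroup_rel_eq (Or.inr ⟨i, j, hij, by simp [mul_assoc]⟩)

/-- The canonical monoid homomorphism `B_n⁺ →* B_n`, sending each generator `σ_i` of the
monoid to the corresponding generator of the group. -/
def toBraidGroup (n : ℕ) : BraidMonoid n →* BraidGroup n :=
  PresentedMonoid.lift (fun i => σG (n := n) i) (braidRels_hold n)

theorem toBraidGroup_sigma (n : ℕ) (i : Fin (n - 1)) : toBraidGroup n (σ i) = σG i := rfl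

/-- `descG n k = σ_k σ_{k-1} ⋯ σ_1` in the braid group `B_n` (1-based indices). -/
def descG (n : ℕ) : ℕ → BraidGroup n
  | 0 => 1
  | k + 1 => (if h : k < n - 1 then σG ⟨k, h⟩ else 1) * descG n k

/-- `deltaAuxG n m` is Garside's fundamental element `Δ_m` computed inside `B_n`:
`Δ_1 = 1` and `Δ_{m+1} = Δ_m ⬝ (σ_m σ_{m-1} ⋯ σ_1)`. -/
def deltaAuxG (n : ℕ) : ℕ → BraidGroup n
  | 0 => 1
  | m + 1 => deltaAuxG n m * descG n m

/-- Garside's fundamental element `Δ_n`, as an element of the braid group `B_n`. -/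
def ΔG (n : ℕ) : BraidGroup n := deltaAuxG n n

/-- The generator `σG` extended by `1` to all natural indices. -/
def sigmaNat (n i : ℕ) : BraidGroup n := if h : i < n - 1 then σG ⟨i, h⟩ else 1

theorem descG_zero (n : ℕ) : descG n 0 = 1 := rfl

theorem descG_succ (n k : ℕ) : descG n (k + 1) = sigmaNat n k * descG n k := rfl

theorem deltaAuxG_succ (n m : ℕ) : deltaAuxG n (m + 1) = deltaAuxG n m * descG n m := rfl

theorem sigmaNat_commute (n : ℕ) {i j : ℕ} (hij : i + 2 ≤ j) :
    Commute (sigmaNat n i) (sigmaNat n j) := by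
  unfold sigmaNat
  by_cases hj : j < n - 1
  · rw [dif_pos hj, dif_pos (by omega : i < n - 1)]
    exact braidRels_hold n _ _ (Or.inr ⟨⟨i, by omega⟩, ⟨j, hj⟩, hij, rfl, rfl⟩)
  · rw [dif_neg hj]
    exact Commute.one_right _

theorem sigmaNat_braid (n : ℕ) {i : ℕ} (hi : i + 1 < n - 1) :
    sigmaNat n i * (sigmaNat n (i + 1) * sigmaNat n i) =
      sigmaNat n (i + 1) * (sigmaNat n i * sigmaNat n (i + 1)) := by
  unfold sigmaNat
  rw [dif_pos hi, dif_pos (by omega : i < n - 1), ← mul_assoc, ← mul_assoc]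
  exact braidRels_hold n _ _ (Or.inl ⟨⟨i, by omega⟩, ⟨i + 1, hi⟩, rfl, rfl, rfl⟩)

theorem descG_commute (n : ℕ) {k j : ℕ} (hkj : k + 1 ≤ j) :
    Commute (descG n k) (sigmaNat n j) := by
  induction k with
  | zero => exact Commute.one_left _
  | succ k ih => exact (sigmaNat_commute n hkj).mul_left (ih (by omega))

theorem deltaAuxG_commute (n : ℕ) {m j : ℕ} (hmj : m ≤ j) :
    Commute (deltaAuxG n m) (sigmaNat n j) := by
  induction m with
  | zero => exact Commute.one_left _
  | succ m ih => exact (ih (by omega)).mul_left (descG_commute n hmj)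

theorem descG_mul_sigmaNat (n : ℕ) {k i : ℕ} (hk : k ≤ n - 1) (hi : i + 1 < k) :
    descG n k * sigmaNat n (i + 1) = sigmaNat n i * descG n k := by
  induction k with
  | zero => omega
  | succ k ih =>
    obtain rfl | hlt := eq_or_lt_of_le (by omega : i + 1 ≤ k)
    · rw [descG_succ, descG_succ, mul_assoc, mul_assoc,
        (descG_commute n (le_refl (i + 1))).eq, ← mul_assoc (sigmaNat n i),
        ← mul_assoc (sigmaNat n (i + 1)), ← sigmaNat_braid n (by omega)]
      simp only [mul_assoc]
    · rw [descG_succ, mul_assoc, ih (by omega) hlt, ← mul_assoc, ← mul_assoc,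
        (sigmaNat_commute n (by omega : i + 2 ≤ k)).eq]

theorem descG_mul_descG (n : ℕ) {k j : ℕ} (hk : k + 1 ≤ n - 1) (hj : j ≤ k) :
    descG n j * (descG n (k + 1) * sigmaNat n 0) = descG n (k + 1) * descG n (j + 1) := by
  induction j with
  | zero => rw [descG_succ n 0, descG_zero, one_mul, mul_one]
  | succ j ih =>
    rw [descG_succ n j, mul_assoc, ih (by omega), ← mul_assoc,
      ← descG_mul_sigmaNat n hk (by omega), mul_assoc, ← descG_succ]

theorem deltaAuxG_mul_sigmaNat (n : ℕ) {m i j : ℕ} (hm : m ≤ n) (hij : i + j + 2 = m) :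
    deltaAuxG n m * sigmaNat n i = sigmaNat n j * deltaAuxG n m := by
  induction m generalizing i with
  | zero => omega
  | succ m ih =>
    rcases i with _ | i
    · obtain rfl : m = j + 1 := by omega
      rw [deltaAuxG_succ, deltaAuxG_succ, mul_assoc, mul_assoc,
        descG_mul_descG n (by omega) le_rfl]
      conv_lhs => rw [descG_succ, mul_assoc]
      rw [← mul_assoc, (deltaAuxG_commute n le_rfl).eq]
      simp only [descG_succ, mul_assoc]
    · rw [deltaAuxG_succ, mul_assoc, descG_mul_sigmaNat n (by omega) (by omega), ← mul_assoc,
        ih (by omega) (by omega), mul_assoc]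

theorem sigmaNat_mem (n i : ℕ) : sigmaNat n i ∈ MonoidHom.mrange (toBraidGroup n) := by
  unfold sigmaNat
  split_ifs with h
  · exact ⟨σ ⟨i, h⟩, rfl⟩
  · exact one_mem _

theorem descG_mem (n k : ℕ) : descG n k ∈ MonoidHom.mrange (toBraidGroup n) := by
  induction k with
  | zero => exact one_mem _
  | succ k ih => exact mul_mem (sigmaNat_mem n k) ih

theorem deltaAuxG_mem (n m : ℕ) : deltaAuxG n m ∈ MonoidHom.mrange (toBraidGroup n) := by
  induction m with
  | zero => exact one_mem _
  | succ m ih => exact mul_mem ih (descG_mem n m)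

theorem descG_succ_mul_inv_mem (n k : ℕ) :
    descG n (k + 1) * (sigmaNat n 0)⁻¹ ∈ MonoidHom.mrange (toBraidGroup n) := by
  induction k with
  | zero => simp [descG_succ, descG_zero]
  | succ k ih =>
    rw [descG_succ, mul_assoc]
    exact mul_mem (sigmaNat_mem n _) ih

/-- `Δ_m` is right divisible, in the positive monoid, by each of its generators. -/
theorem deltaAuxG_mul_inv_mem (n : ℕ) {m i : ℕ} (hm : m ≤ n) (hi : i + 1 < m) :
    deltaAuxG n m * (sigmaNat n i)⁻¹ ∈ MonoidHom.mrange (toBraidGroup n) := by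
  induction m generalizing i with
  | zero => omega
  | succ m ih =>
    rcases i with _ | i
    · obtain ⟨k, rfl⟩ : ∃ k, m = k + 1 := ⟨m - 1, by omega⟩
      rw [deltaAuxG_succ, mul_assoc]
      exact mul_mem (deltaAuxG_mem n _) (descG_succ_mul_inv_mem n k)
    · have h : descG n m * (sigmaNat n (i + 1))⁻¹ = (sigmaNat n i)⁻¹ * descG n m := by
        rw [mul_inv_eq_iff_eq_mul, mul_assoc, descG_mul_sigmaNat n (by omega) (by omega),
          inv_mul_cancel_left]
      rw [deltaAuxG_succ, mul_assoc, h, ← mul_assoc]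
      exact mul_mem (ih (by omega) (by omega)) (descG_mem n m)

theorem ΔG_conj_mem (n : ℕ) (g : BraidMonoid n) :
    ΔG n * toBraidGroup n g * (ΔG n)⁻¹ ∈ MonoidHom.mrange (toBraidGroup n) := by
  have key : ∀ w : FreeMonoid (Fin (n - 1)),
      ΔG n * FreeMonoid.lift (fun i => σG (n := n) i) w * (ΔG n)⁻¹ ∈
        MonoidHom.mrange (toBraidGroup n) := by
    intro w
    induction w using FreeMonoid.inductionOn' with
    | one => simp
    | of_mul i w ih =>
      have h : ΔG n * σG i = sigmaNat n (n - 2 - i) * ΔG n := by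
        have hi := i.isLt
        have := deltaAuxG_mul_sigmaNat n (i := i) (j := n - 2 - i) le_rfl (by omega)
        rwa [sigmaNat, dif_pos hi] at this
      rw [map_mul, FreeMonoid.lift_eval_of, ← mul_assoc, h, mul_assoc, mul_assoc,
        ← mul_assoc (ΔG n)]
      exact mul_mem (sigmaNat_mem n _) ih
  exact PresentedMonoid.inductionOn (rels₁ := braidRels n)
    (δ := fun g => ΔG n * toBraidGroup n g * (ΔG n)⁻¹ ∈ MonoidHom.mrange (toBraidGroup n)) g key

theorem ΔG_mul_inv_mem (n : ℕ) (i : Fin (n - 1)) :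
    ΔG n * (σG i)⁻¹ ∈ MonoidHom.mrange (toBraidGroup n) := by
  have hi := i.isLt
  have := deltaAuxG_mul_inv_mem n (i := i) le_rfl (by omega)
  rwa [sigmaNat, dif_pos hi] at this

/-- Every element of the braid group `B_n` can be expressed as a fraction `Δ_n ^ m · g`
with `m ∈ ℤ` and `g` in the image of the positive braid monoid `B_n⁺` under the canonical
homomorphism `B_n⁺ → B_n`. -/
theorem braidGroup_delta_fraction (n : ℕ) (hn : 1 ≤ n) (x : BraidGroup n) :
    ∃ (m : ℤ) (g : BraidMonoid n), x = ΔG n ^ m * toBraidGroup n g := by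
  have htop : Subgroup.closure (Set.range (σG (n := n))) = ⊤ :=
    PresentedGroup.closure_range_of (braidRelsGroup n)
  have hx : x ∈ Subgroup.closure (Set.range (σG (n := n))) := htop ▸ Subgroup.mem_top x
  induction hx using Subgroup.closure_induction_right with
  | one => exact ⟨0, 1, by simp⟩
  | mul_right x _ y hy ih =>
    obtain ⟨i, rfl⟩ := hy
    obtain ⟨m, g, rfl⟩ := ih
    exact ⟨m, g * σ i, by rw [map_mul, toBraidGroup_sigma, mul_assoc]⟩
  | mul_inv_cancel x _ y hy ih =>
    obtain ⟨i, rfl⟩ := hy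
    obtain ⟨m, g, rfl⟩ := ih
    obtain ⟨p, hp⟩ := ΔG_conj_mem n g
    obtain ⟨q, hq⟩ := ΔG_mul_inv_mem n i
    refine ⟨m - 1, p * q, ?_⟩
    rw [map_mul, hp, hq, zpow_sub_one]
    group
end

section
/- For every i with 1 ≤ i ≤ n−1, the generator σ_i both left-divides and right-divides Garside's fundamental element Δ_n in the positive braid monoid B_n^+: there exist c, c' in B_n^+ with Δ_n = σ_i * c and Δ_n = c' * σ_i. -/
/-- The generator `σ_{k+1}` of `B_n⁺`, extended by `1` to all natural numbers `k`. -/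
def gen (n k : ℕ) : BraidMonoid n := if h : k < n - 1 then σ ⟨k, h⟩ else 1

/-- `asc n k = σ_1 σ_2 ⋯ σ_k` (1-based indices). -/
def asc (n : ℕ) : ℕ → BraidMonoid n
  | 0 => 1
  | k + 1 => asc n k * gen n k

theorem gen_of_lt {n k : ℕ} (h : k < n - 1) : gen n k = σ ⟨k, h⟩ := dif_pos h

theorem desc_succ (n k : ℕ) : desc n (k + 1) = gen n k * desc n k := rfl

theorem asc_succ (n k : ℕ) : asc n (k + 1) = asc n k * gen n k := rfl

theorem deltaAux_succ (n m : ℕ) : deltaAux n (m + 1) = deltaAux n m * desc n m := rfl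

theorem gen_braid {n i : ℕ} (h : i + 1 < n - 1) :
    gen n i * gen n (i + 1) * gen n i = gen n (i + 1) * gen n i * gen n (i + 1) := by
  rw [gen_of_lt h, gen_of_lt (show i < n - 1 by omega)]
  exact Quotient.sound (ConGen.Rel.of _ _ (Or.inl ⟨_, _, rfl, rfl, rfl⟩))

theorem commute_gen_gen {n i j : ℕ} (h : i + 2 ≤ j) : Commute (gen n i) (gen n j) := by
  by_cases hj : j < n - 1
  · rw [gen_of_lt hj, gen_of_lt (show i < n - 1 by omega)]
    exact Quotient.sound (ConGen.Rel.of _ _ (Or.inr ⟨_, _, h, rfl, rfl⟩))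
  · rw [show gen n j = 1 from dif_neg hj]
    exact Commute.one_right _

theorem commute_gen_desc {n j k : ℕ} (h : k < j) : Commute (gen n j) (desc n k) := by
  induction k with
  | zero => exact Commute.one_right _
  | succ k ih => exact (commute_gen_gen (by omega)).symm.mul_right (ih (by omega))

theorem commute_gen_asc {n j k : ℕ} (h : k < j) : Commute (gen n j) (asc n k) := by
  induction k with
  | zero => exact Commute.one_right _
  | succ k ih => exact (ih (by omega)).mul_right (commute_gen_gen (by omega)).symm

theorem commute_gen_deltaAux {n j m : ℕ} (h : m ≤ j) : Commute (gen n j) (deltaAux n m) := by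
  induction m with
  | zero => exact Commute.one_right _
  | succ m ih => exact (ih (by omega)).mul_right (commute_gen_desc (by omega))

theorem gen_mul_desc {n i k : ℕ} (hi : i + 1 < k) (hk : k ≤ n - 1) :
    gen n i * desc n k = desc n k * gen n (i + 1) := by
  induction k, hi using Nat.le_induction with
  | base =>
    calc gen n i * desc n (i + 1 + 1)
        = gen n i * gen n (i + 1) * gen n i * desc n i := by simp only [desc_succ, mul_assoc]
      _ = gen n (i + 1) * gen n i * (gen n (i + 1) * desc n i) := by
          rw [gen_braid (by omega), mul_assoc]
      _ = desc n (i + 1 + 1) * gen n (i + 1) := by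
          rw [(commute_gen_desc (by omega)).eq]; simp only [desc_succ, mul_assoc]
  | succ k hi ih =>
    rw [desc_succ, ← mul_assoc, (commute_gen_gen hi).eq, mul_assoc, ih (by omega), mul_assoc]

theorem asc_mul_gen {n i k : ℕ} (hi : i + 1 < k) (hk : k ≤ n - 1) :
    asc n k * gen n i = gen n (i + 1) * asc n k := by
  induction k, hi using Nat.le_induction with
  | base =>
    calc asc n (i + 1 + 1) * gen n i
        = asc n i * (gen n i * gen n (i + 1) * gen n i) := by simp only [asc_succ, mul_assoc]
      _ = asc n i * gen n (i + 1) * (gen n i * gen n (i + 1)) := by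
          rw [gen_braid (by omega)]; simp only [mul_assoc]
      _ = gen n (i + 1) * asc n (i + 1 + 1) := by
          rw [← (commute_gen_asc (by omega)).eq]; simp only [asc_succ, mul_assoc]
  | succ k hi ih =>
    rw [asc_succ, mul_assoc, ← (commute_gen_gen hi).eq, ← mul_assoc, ih (by omega), mul_assoc]

theorem deltaAux_succ_eq_asc_mul (n m : ℕ) :
    deltaAux n (m + 1) = asc n m * deltaAux n m := by
  induction m with
  | zero => rfl
  | succ m ih =>
    calc deltaAux n (m + 1 + 1) = deltaAux n (m + 1) * gen n m * desc n m := by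
          rw [deltaAux_succ n (m + 1), desc_succ, mul_assoc]
      _ = asc n m * (deltaAux n m * gen n m) * desc n m := by rw [ih, mul_assoc (asc n m)]
      _ = asc n (m + 1) * deltaAux n (m + 1) := by
          rw [← (commute_gen_deltaAux le_rfl).eq]
          simp only [asc_succ, deltaAux_succ, mul_assoc]

theorem exists_asc_succ_eq_gen_zero_mul (n k : ℕ) : ∃ c, asc n (k + 1) = gen n 0 * c := by
  induction k with
  | zero => exact ⟨1, by simp [asc]⟩
  | succ k ih =>
    obtain ⟨c, hc⟩ := ih
    exact ⟨c * gen n (k + 1), by rw [asc_succ, hc, mul_assoc]⟩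

theorem exists_desc_succ_eq_mul_gen_zero (n k : ℕ) : ∃ c, desc n (k + 1) = c * gen n 0 := by
  induction k with
  | zero => exact ⟨1, (mul_one _).trans (one_mul _).symm⟩
  | succ k ih =>
    obtain ⟨c, hc⟩ := ih
    exact ⟨gen n (k + 1) * c, by rw [desc_succ, hc, mul_assoc]⟩

theorem exists_deltaAux_eq_gen_mul {n m i : ℕ} (hm : m ≤ n) (hi : i + 1 < m) :
    ∃ c, deltaAux n m = gen n i * c := by
  induction m generalizing i with
  | zero => omega
  | succ m ih =>
    rw [deltaAux_succ_eq_asc_mul]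
    cases i with
    | zero =>
      obtain ⟨k, rfl⟩ : ∃ k, m = k + 1 := ⟨m - 1, by omega⟩
      obtain ⟨c, hc⟩ := exists_asc_succ_eq_gen_zero_mul n k
      exact ⟨c * deltaAux n (k + 1), by rw [hc, mul_assoc]⟩
    | succ i =>
      obtain ⟨c, hc⟩ := ih (i := i) (by omega) (by omega)
      exact ⟨asc n m * c, by
        rw [hc, ← mul_assoc, asc_mul_gen (by omega) (by omega), mul_assoc]⟩

theorem exists_deltaAux_eq_mul_gen {n m i : ℕ} (hm : m ≤ n) (hi : i + 1 < m) :
    ∃ c, deltaAux n m = c * gen n i := by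
  induction m generalizing i with
  | zero => omega
  | succ m ih =>
    rw [deltaAux_succ]
    cases i with
    | zero =>
      obtain ⟨k, rfl⟩ : ∃ k, m = k + 1 := ⟨m - 1, by omega⟩
      obtain ⟨c, hc⟩ := exists_desc_succ_eq_mul_gen_zero n k
      exact ⟨deltaAux n (k + 1) * c, by rw [hc, mul_assoc]⟩
    | succ i =>
      obtain ⟨c, hc⟩ := ih (i := i) (by omega) (by omega)
      exact ⟨c * desc n m, by
        rw [hc, mul_assoc, gen_mul_desc (by omega) (by omega), mul_assoc]⟩

/-- Every generator `σ_i` (for `1 ≤ i ≤ n - 1`) both left-divides and right-divides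
Garside's fundamental element `Δ_n` in the positive braid monoid `B_n⁺`. -/
theorem sigma_dvd_delta (n : ℕ) (hn : 1 ≤ n) (i : Fin (n - 1)) :
    (∃ c : BraidMonoid n, Δ n = σ i * c) ∧ (∃ c' : BraidMonoid n, Δ n = c' * σ i) := by
  have hi : (i : ℕ) + 1 < n := by omega
  rw [← gen_of_lt i.isLt]
  exact ⟨exists_deltaAux_eq_gen_mul le_rfl hi, exists_deltaAux_eq_mul_gen le_rfl hi⟩
end
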